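/- arXiv:1203.5175 — 5 statements merged into one kernel-verified Lean document; each statement's English description precedes it below -/
import Mathlib

section
/- Every maximal chain of P_G has exactly r+1 elements and can be written as {(C_0,v), (C_1,v), …, (C_r,v)} for a single vertex v of G and a maximal nested family ∅ = C_0 ⊂ C_1 ⊂ ⋯ ⊂ C_r = R of subsets of R with |C_j| = j for each j; conversely, for every vertex v and every such maximal nested family of subsets of R, the set {(C_0,v), …, (C_r,v)} is a maximal chain of P_G. -/
open SimpleGraph

variable {V R : Type*}

/-- The spanning subgraph of `G` keeping only the edges whose color lies in `C`. -/
def colorSub (G : SimpleGraph V) (c : V → V → R) (C : Finset R) : SimpleGraph V :=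
  SimpleGraph.fromRel (fun a b => G.Adj a b ∧ c a b ∈ C)

/-- `v` and `w` are `C`-equivalent: joined by a walk all of whose edges have colors in `C`. -/
def cEquiv (G : SimpleGraph V) (c : V → V → R) (C : Finset R) (v w : V) : Prop :=
  (colorSub G c C).Reachable v w

/-- `c` is a proper edge coloring of `G` such that at each vertex the colors of the incident
edges are pairwise distinct and exhaust the color set `R`
(so `G` is a properly edge-colored `|R|`-regular graph). -/
structure IsProperColoring (G : SimpleGraph V) (c : V → V → R) : Prop where
  symm : ∀ v w, G.Adj v w → c v w = c w v
  bijOn : ∀ v : V, Set.BijOn (fun w => c v w) (G.neighborSet v) Set.univ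

/-- The preorder on pairs `(C, v)`. -/
def faceLE (G : SimpleGraph V) (c : V → V → R) (p q : Finset R × V) : Prop :=
  p.1 ⊆ q.1 ∧ cEquiv G c q.1 p.2 q.2

/-- The identification `(C,v) = (D,w)` iff `C = D` and `v ∼_C w`. -/
def faceSetoid (G : SimpleGraph V) (c : V → V → R) : Setoid (Finset R × V) where
  r p q := p.1 = q.1 ∧ cEquiv G c p.1 p.2 q.2
  iseqv := by
    constructor
    · exact fun p => ⟨rfl, SimpleGraph.Reachable.refl _⟩
    · rintro p q ⟨h1, h2⟩
      refine ⟨h1.symm, ?_⟩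
      rw [← h1]
      exact h2.symm
    · rintro p q u ⟨h1, h2⟩ ⟨h3, h4⟩
      refine ⟨h1.trans h3, h2.trans ?_⟩
      rw [h1]
      exact h4

lemma colorSub_mono (G : SimpleGraph V) (c : V → V → R) {C D : Finset R} (h : C ⊆ D) :
    colorSub G c C ≤ colorSub G c D := by
  intro a b hab
  obtain ⟨hne, h'⟩ := hab
  exact ⟨hne, h'.imp (fun hx => ⟨hx.1, h hx.2⟩) (fun hx => ⟨hx.1, h hx.2⟩)⟩

lemma cEquiv_mono (G : SimpleGraph V) (c : V → V → R) {C D : Finset R} (h : C ⊆ D)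
    {v w : V} (hvw : cEquiv G c C v w) : cEquiv G c D v w :=
  hvw.mono (colorSub_mono G c h)

/-- The faces of the colorful polytope `P_G`. -/
def ColorfulFace (G : SimpleGraph V) (c : V → V → R) : Type _ :=
  Quotient (faceSetoid G c)

/-- The face of `P_G` represented by the pair `(C, v)`. -/
def mkFace (G : SimpleGraph V) (c : V → V → R) (C : Finset R) (v : V) : ColorfulFace G c :=
  Quotient.mk (faceSetoid G c) (C, v)

/-- The partial order of the colorful polytope `P_G`. -/
instance ColorfulFace.instPartialOrder (G : SimpleGraph V) (c : V → V → R) :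
    PartialOrder (ColorfulFace G c) where
  le := Quotient.lift₂ (faceLE G c) (by
    rintro p q p' q' ⟨hp1, hp2⟩ ⟨hq1, hq2⟩
    ext
    constructor
    · rintro ⟨hsub, hreach⟩
      constructor
      · rw [← hp1, ← hq1]; exact hsub
      · rw [← hq1]
        have h1 : cEquiv G c q.1 p'.2 p.2 := cEquiv_mono G c hsub (hp1 ▸ hp2.symm)
        exact (h1.trans hreach).trans hq2
    · rintro ⟨hsub, hreach⟩
      constructor
      · rw [hp1, hq1]; exact hsub
      · rw [hq1]
        have h2 : cEquiv G c q'.1 p.2 p'.2 := by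
          refine cEquiv_mono G c ?_ hp2
          rw [hp1]; exact hsub
        refine (h2.trans hreach).trans ?_
        rw [hq1] at hq2
        exact hq2.symm)
  le_refl := by
    refine Quotient.ind (fun p => ?_)
    exact ⟨subset_rfl, SimpleGraph.Reachable.refl _⟩
  le_trans := by
    refine Quotient.ind fun p => Quotient.ind fun q => Quotient.ind fun u => ?_
    rintro ⟨h1, h2⟩ ⟨h3, h4⟩
    exact ⟨h1.trans h3, (cEquiv_mono G c h3 h2).trans h4⟩
  le_antisymm := by
    refine Quotient.ind fun p => Quotient.ind fun q => ?_
    rintro ⟨h1, h2⟩ ⟨h3, h4⟩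
    exact Quotient.sound ⟨subset_antisymm h1 h3, subset_antisymm h3 h1 ▸ h2⟩

/-- The rank of a face of `P_G`. -/
def faceRank (G : SimpleGraph V) (c : V → V → R) : ColorfulFace G c → ℕ :=
  Quotient.lift (fun p => p.1.card) (fun p q h => by
    show p.1.card = q.1.card
    rw [(h.1 : p.1 = q.1)])

/-- Taking faces at a fixed vertex embeds the subsets of `R` into `P_G`. -/
lemma mkFace_le_mkFace_iff (G : SimpleGraph V) (c : V → V → R) {C D : Finset R} {v : V} :
    mkFace G c C v ≤ mkFace G c D v ↔ C ⊆ D :=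
  ⟨fun h => h.1, fun h => ⟨h, SimpleGraph.Reachable.refl _⟩⟩

/-- Every face above `(C, v)` contains the vertex `v`. -/
lemma exists_eq_mkFace_of_mkFace_le (G : SimpleGraph V) (c : V → V → R) {C : Finset R} {v : V}
    {F : ColorfulFace G c} (h : mkFace G c C v ≤ F) : ∃ D, F = mkFace G c D v := by
  induction F using Quotient.ind with
  | _ p => exact ⟨p.1, Quotient.sound ⟨rfl, h.2.symm⟩⟩

/-- A face below another face of at most the same rank equals it. -/
lemma eq_of_le_of_faceRank_le (G : SimpleGraph V) (c : V → V → R) {E F : ColorfulFace G c}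
    (h : E ≤ F) (hr : faceRank G c F ≤ faceRank G c E) : E = F := by
  induction E using Quotient.ind with
  | _ p =>
    induction F using Quotient.ind with
    | _ q =>
      have hpq : p.1 = q.1 := Finset.eq_of_subset_of_card_le h.1 hr
      exact Quotient.sound ⟨hpq, hpq ▸ h.2⟩

/-- Comparable subsets are ordered by their cardinalities. -/
lemma IsChain.subset_of_card_le {S : Set (Finset R)} (hS : IsChain (· ≤ ·) S) {C D : Finset R}
    (hC : C ∈ S) (hD : D ∈ S) (h : C.card ≤ D.card) : C ⊆ D := by
  rcases hS.total hC hD with hCD | hDC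
  · exact hCD
  · exact (Finset.eq_of_subset_of_card_le hDC h).ge

/-- A maximal chain of subsets of a finite set contains a subset of every possible size. -/
lemma IsMaxChain.exists_card_eq [Fintype R] {S : Set (Finset R)} (hS : IsMaxChain (· ≤ ·) S)
    {j : ℕ} (hj : j ≤ Fintype.card R) : ∃ C ∈ S, C.card = j := by
  classical
  have hbot : (∅ : Finset R) ∈ S := hS.bot_mem
  have htop : (Finset.univ : Finset R) ∈ S := hS.top_mem
  obtain ⟨A, ⟨hA, hAj⟩, hAmax⟩ := (Set.toFinite {C ∈ S | C.card ≤ j}).exists_maximalFor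
    Finset.card _ ⟨∅, hbot, by simp⟩
  obtain ⟨B, ⟨hB, hjB⟩, hBmin⟩ := (Set.toFinite {C ∈ S | j ≤ C.card}).exists_minimalFor
    Finset.card _ ⟨Finset.univ, htop, by simpa using hj⟩
  obtain ⟨D, hAD, hDB, hD⟩ := Finset.exists_subsuperset_card_eq
    (hS.1.subset_of_card_le hA hB (hAj.trans hjB)) hAj hjB
  have hins : IsChain (· ≤ ·) (insert D S) := by
    refine hS.1.insert fun C hC _ => ?_
    rcases le_total C.card j with hCj | hjC
    · have hCA : C.card ≤ A.card := (le_total C.card A.card).elim id (hAmax ⟨hC, hCj⟩)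
      exact Or.inr ((hS.1.subset_of_card_le hC hA hCA).trans hAD)
    · have hBC : B.card ≤ C.card := (le_total B.card C.card).elim id (hBmin ⟨hC, hjC⟩)
      exact Or.inl (hDB.trans (hS.1.subset_of_card_le hB hC hBC))
  refine ⟨D, ?_, hD⟩
  rw [hS.2 hins (Set.subset_insert D S)]
  exact Set.mem_insert D S

/-- Every chain of subsets of a finite set refines to a full nested family. -/
lemma IsChain.exists_nested_family [Fintype R] {S : Set (Finset R)} (hS : IsChain (· ≤ ·) S) :
    ∃ f : Fin (Fintype.card R + 1) → Finset R,
      Monotone f ∧ (∀ j, (f j).card = j.val) ∧ S ⊆ Set.range f := by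
  obtain ⟨T, hT, hST⟩ := hS.exists_maxChain
  choose f hfT hf using fun j : Fin (Fintype.card R + 1) =>
    hT.exists_card_eq (Nat.lt_succ_iff.mp j.isLt)
  refine ⟨f, fun i j hij => ?_, hf, fun C hC => ?_⟩
  · exact hT.1.subset_of_card_le (hfT i) (hfT j) (by simpa [hf] using hij)
  · let j : Fin (Fintype.card R + 1) := ⟨C.card, Nat.lt_succ_iff.mpr C.card_le_univ⟩
    refine ⟨j, subset_antisymm ?_ ?_⟩
    · exact hT.1.subset_of_card_le (hfT j) (hST hC) (hf j).le
    · exact hT.1.subset_of_card_le (hST hC) (hfT j) (hf j).ge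

/-- A nested family at a vertex gives a chain of faces. -/
lemma isChain_range_mkFace (G : SimpleGraph V) (c : V → V → R) (v : V) {n : ℕ}
    {f : Fin n → Finset R} (hf : Monotone f) :
    IsChain (· ≤ ·) (Set.range fun j => mkFace G c (f j) v) := by
  have hmono : Monotone fun j => mkFace G c (f j) v := fun _ _ hij =>
    (mkFace_le_mkFace_iff G c).2 (hf hij)
  exact hmono.isChain_range

/-- A full nested family at a vertex gives a maximal chain of faces. -/
lemma isMaxChain_range_mkFace [Fintype R] (G : SimpleGraph V) (c : V → V → R) (v : V)
    {f : Fin (Fintype.card R + 1) → Finset R} (hf : Monotone f)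
    (hcard : ∀ j, (f j).card = j.val) :
    IsMaxChain (· ≤ ·) (Set.range fun j => mkFace G c (f j) v) := by
  refine ⟨isChain_range_mkFace G c v hf, fun T hT hsub => hsub.antisymm fun F hF => ?_⟩
  have hrank : faceRank G c F ≤ Fintype.card R := by
    induction F using Quotient.ind with
    | _ p => exact p.1.card_le_univ
  let j : Fin (Fintype.card R + 1) := ⟨faceRank G c F, Nat.lt_succ_iff.mpr hrank⟩
  have hj : faceRank G c (mkFace G c (f j) v) = faceRank G c F := hcard j
  refine ⟨j, ?_⟩
  rcases hT.total (hsub ⟨j, rfl⟩) hF with h | h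
  · exact eq_of_le_of_faceRank_le G c h hj.ge
  · exact (eq_of_le_of_faceRank_le G c h hj.le).symm

/-- The faces of a nonempty finite chain have a common vertex. -/
lemma IsChain.exists_common_vertex (G : SimpleGraph V) (c : V → V → R)
    {S : Set (ColorfulFace G c)} (hS : IsChain (· ≤ ·) S) (hfin : S.Finite) (hne : S.Nonempty) :
    ∃ v : V, S ⊆ Set.range fun C => mkFace G c C v := by
  obtain ⟨E, hE⟩ := hfin.exists_minimal hne
  obtain ⟨⟨C, v⟩, rfl⟩ := Quotient.exists_rep E
  refine ⟨v, fun F hF => ?_⟩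
  have hle : mkFace G c C v ≤ F := (hS.total hE.1 hF).elim id (hE.2 hF)
  obtain ⟨D, rfl⟩ := exists_eq_mkFace_of_mkFace_le G c hle
  exact ⟨D, rfl⟩

/-- A maximal chain of faces comes from a full nested family at a vertex. -/
lemma IsMaxChain.exists_eq_range_mkFace [Finite V] [Nonempty V] [Fintype R]
    (G : SimpleGraph V) (c : V → V → R) {S : Set (ColorfulFace G c)}
    (hS : IsMaxChain (· ≤ ·) S) :
    ∃ (v : V) (f : Fin (Fintype.card R + 1) → Finset R),
      Monotone f ∧ (∀ j, (f j).card = j.val) ∧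
      S = Set.range (fun j => mkFace G c (f j) v) := by
  have : Finite (ColorfulFace G c) := inferInstanceAs (Finite (Quotient (faceSetoid G c)))
  have : Nonempty (ColorfulFace G c) := ⟨mkFace G c ∅ (Classical.arbitrary V)⟩
  obtain ⟨v, hv⟩ := hS.1.exists_common_vertex G c S.toFinite (hS.nonempty_iff.1 this)
  have hchain : IsChain (· ≤ ·) {C | mkFace G c C v ∈ S} := fun C hC D hD _ =>
    (hS.1.total hC hD).imp (mkFace_le_mkFace_iff G c).1 (mkFace_le_mkFace_iff G c).1
  obtain ⟨f, hf, hcard, hsub⟩ := hchain.exists_nested_family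
  refine ⟨v, f, hf, hcard, hS.2 (isChain_range_mkFace G c v hf) fun F hF => ?_⟩
  obtain ⟨C, rfl⟩ := hv hF
  obtain ⟨j, rfl⟩ := hsub hF
  exact ⟨j, rfl⟩

/-- every flag (maximal chain) of the colorful polytope `P_G` has exactly
`r + 1` elements and is of the form `{(C_0,v), …, (C_r,v)}` for a single vertex `v` and a
maximal nested family `∅ = C_0 ⊂ C_1 ⊂ ⋯ ⊂ C_r = R` with `|C_j| = j`; conversely every
such family yields a maximal chain. -/
theorem colorful_flags_iff_nested_families
    {V R : Type*} [Fintype V] [Fintype R] [DecidableEq R]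
    (G : SimpleGraph V) (hconn : G.Connected) (c : V → V → R)
    (hc : IsProperColoring G c) (S : Set (ColorfulFace G c)) :
    (IsMaxChain (· ≤ ·) S → S.ncard = Fintype.card R + 1) ∧
    (IsMaxChain (· ≤ ·) S ↔
      ∃ (v : V) (f : Fin (Fintype.card R + 1) → Finset R),
        Monotone f ∧ (∀ j, (f j).card = j.val) ∧
        S = Set.range (fun j => mkFace G c (f j) v)) := by
  have := hconn.nonempty
  refine ⟨fun hS => ?_, fun hS => hS.exists_eq_range_mkFace G c, ?_⟩
  · obtain ⟨v, f, -, hcard, rfl⟩ := hS.exists_eq_range_mkFace G c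
    have hinj : Function.Injective fun j => mkFace G c (f j) v := fun i j hij => by
      have hr : (f i).card = (f j).card := congrArg (faceRank G c) hij
      exact Fin.ext (by rwa [hcard, hcard] at hr)
    rw [Set.ncard_range_of_injective hinj, Nat.card_eq_fintype_card, Fintype.card_fin]
  · rintro ⟨v, f, hf, hcard, rfl⟩
    exact isMaxChain_range_mkFace G c v hf hcard
end

section
/- For every vertex v of G, the map C ↦ (C,v) is an order isomorphism from the power set of R, ordered by inclusion, onto the set {F ∈ P_G : (∅,v) ≤ F} of faces of P_G above the rank-0 face (∅,v), ordered by the induced order; in particular the vertex-figure of P_G at every vertex is a Boolean lattice of rank r (an (r−1)-simplex), so P_G is a simple poset of rank r. -/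
open SimpleGraph

variable {V R : Type*}

/-- for every vertex `v` of `G`, the map `C ↦ (C,v)` is an order isomorphism
from the power set of `R` (ordered by inclusion) onto the set of faces of `P_G` lying above
the rank-0 face `(∅,v)`; in particular every vertex-figure of `P_G` is a Boolean lattice of
rank `r` (an `(r-1)`-simplex), so `P_G` is a simple poset of rank `r`. -/
theorem colorful_vertex_figure_boolean
    {V R : Type*} [Fintype V] [Fintype R] [DecidableEq R]
    (G : SimpleGraph V) (hconn : G.Connected) (c : V → V → R)
    (hc : IsProperColoring G c) (v : V) :
    ∃ e : Finset R ≃o {F : ColorfulFace G c // mkFace G c ∅ v ≤ F},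
      ∀ C : Finset R, (e C : ColorfulFace G c) = mkFace G c C v := by
  have mem (C : Finset R) : mkFace G c ∅ v ≤ mkFace G c C v :=
    ⟨Finset.empty_subset C, SimpleGraph.Reachable.refl v⟩
  let f : Finset R ↪o {F : ColorfulFace G c // mkFace G c ∅ v ≤ F} :=
    OrderEmbedding.ofMapLEIff (fun C => ⟨mkFace G c C v, mem C⟩) fun _ _ =>
      ⟨fun h => h.1, fun h => ⟨h, SimpleGraph.Reachable.refl v⟩⟩
  have hf : Function.Surjective f := by
    rintro ⟨F, hF⟩
    induction F using Quotient.ind with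
    | _ p => exact ⟨p.1, Subtype.ext (Quotient.sound ⟨rfl, hF.2⟩)⟩
  exact ⟨RelIso.ofSurjective f hf, fun _ => rfl⟩
end

section
/- The map v ↦ (∅,v) is a bijection from the vertex set V of G onto the set of rank-0 faces of P_G, and two distinct vertices v and w are adjacent in G if and only if the faces (∅,v) and (∅,w) lie below a common rank-1 face of P_G; moreover, in that case this common rank-1 face is unique, namely ({a},v), where a is the color of the edge joining v and w. Hence the 1-skeleton of P_G is isomorphic to G. -/
open SimpleGraph

variable {V R : Type*}

lemma mkFace_le_mkFace {G : SimpleGraph V} {c : V → V → R} {C D : Finset R} {v w : V} :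
    mkFace G c C v ≤ mkFace G c D w ↔ C ⊆ D ∧ cEquiv G c D v w :=
  Iff.rfl

lemma IsProperColoring.colorSub_adj {G : SimpleGraph V} {c : V → V → R}
    (hc : IsProperColoring G c) {C : Finset R} {v w : V} :
    (colorSub G c C).Adj v w ↔ G.Adj v w ∧ c v w ∈ C := by
  constructor
  · rintro ⟨-, h | ⟨h, hC⟩⟩
    · exact h
    · exact ⟨h.symm, hc.symm w v h ▸ hC⟩
  · exact fun h => ⟨h.1.ne, Or.inl h⟩

lemma cEquiv_empty {G : SimpleGraph V} {c : V → V → R} {v w : V} :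
    cEquiv G c ∅ v w ↔ v = w := by
  have hbot : colorSub G c ∅ = ⊥ := by
    ext a b
    simp [colorSub]
  rw [cEquiv, hbot, SimpleGraph.reachable_bot]

lemma IsProperColoring.cEquiv_singleton {G : SimpleGraph V} {c : V → V → R}
    (hc : IsProperColoring G c) {a : R} {v w : V} :
    cEquiv G c {a} v w ↔ v = w ∨ G.Adj v w ∧ c v w = a := by
  constructor
  · rintro ⟨p⟩
    induction p with
    | nil => exact Or.inl rfl
    | @cons u x w h p ih =>
      obtain ⟨hux, hcux⟩ := hc.colorSub_adj.1 h
      rw [Finset.mem_singleton] at hcux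
      rcases ih with rfl | ⟨hxw, hcxw⟩
      · exact Or.inr ⟨hux, hcux⟩
      · refine Or.inl ((hc.bijOn x).injOn hux.symm hxw ?_)
        rw [← hc.symm u x hux, hcux, hcxw]
  · rintro (rfl | ⟨h, hca⟩)
    · exact SimpleGraph.Reachable.refl _
    · exact (hc.colorSub_adj.2 ⟨h, Finset.mem_singleton.2 hca⟩).reachable

/-- A rank-1 face above two distinct vertices is spanned by an edge joining them. -/
lemma IsProperColoring.adj_and_eq_mkFace {G : SimpleGraph V} {c : V → V → R}
    (hc : IsProperColoring G c) {v w : V} (hvw : v ≠ w) {F : ColorfulFace G c}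
    (hF : faceRank G c F = 1) (hv : mkFace G c ∅ v ≤ F) (hw : mkFace G c ∅ w ≤ F) :
    G.Adj v w ∧ F = mkFace G c {c v w} v := by
  obtain ⟨⟨C, u⟩, rfl⟩ := Quotient.exists_rep F
  obtain ⟨a, rfl⟩ : ∃ a, C = {a} := Finset.card_eq_one.1 hF
  have hvu : cEquiv G c {a} v u := hv.2
  have hwu : cEquiv G c {a} w u := hw.2
  obtain ⟨hadj, rfl⟩ := (hc.cEquiv_singleton.1 (hvu.trans hwu.symm)).resolve_left hvw
  exact ⟨hadj, Quotient.sound ⟨rfl, hvu.symm⟩⟩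

/-- `v ↦ (∅,v)` is a bijection from the vertices of `G` onto the rank-0 faces
of `P_G`; two distinct vertices `v`, `w` are adjacent in `G` iff `(∅,v)` and `(∅,w)` lie
below a common rank-1 face, and in that case this rank-1 face is unique, namely
`({a},v)` where `a = c v w` is the color of the edge joining `v` and `w`. Hence the
1-skeleton of `P_G` is isomorphic to `G`. -/
theorem colorful_one_skeleton
    {V R : Type*} [Fintype V] [Fintype R] [DecidableEq R]
    (G : SimpleGraph V) (hconn : G.Connected) (c : V → V → R)
    (hc : IsProperColoring G c) :
    Set.BijOn (fun v : V => mkFace G c ∅ v) Set.univ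
      {x : ColorfulFace G c | faceRank G c x = 0} ∧
    (∀ v w : V, v ≠ w →
      ((G.Adj v w ↔ ∃ F : ColorfulFace G c, faceRank G c F = 1 ∧
          mkFace G c ∅ v ≤ F ∧ mkFace G c ∅ w ≤ F) ∧
       (G.Adj v w → ∀ F : ColorfulFace G c, faceRank G c F = 1 →
          mkFace G c ∅ v ≤ F → mkFace G c ∅ w ≤ F → F = mkFace G c {c v w} v))) := by
  refine ⟨⟨fun v _ => rfl, fun v _ w _ h => cEquiv_empty.1 (Quotient.exact h).2, ?_⟩,
    fun v w hvw => ⟨⟨fun h => ?_, ?_⟩, fun _ F hF hv hw => (hc.adj_and_eq_mkFace hvw hF hv hw).2⟩⟩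
  · intro F hF
    obtain ⟨⟨C, u⟩, rfl⟩ := Quotient.exists_rep F
    obtain rfl : C = ∅ := Finset.card_eq_zero.1 hF
    exact ⟨u, trivial, rfl⟩
  · refine ⟨mkFace G c {c v w} v, Finset.card_singleton _,
      mkFace_le_mkFace.2 ⟨Finset.empty_subset _, SimpleGraph.Reachable.refl _⟩,
      mkFace_le_mkFace.2 ⟨Finset.empty_subset _, ?_⟩⟩
    exact (hc.cEquiv_singleton.2 (Or.inr ⟨h, rfl⟩)).symm
  · rintro ⟨F, hF, hv, hw⟩
    exact (hc.adj_and_eq_mkFace hvw hF hv hw).1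
end

section
/- Every order automorphism of P_G that fixes every face of rank 0 and every face of rank 1 is the identity automorphism of P_G. -/
open SimpleGraph

variable {V R : Type*}

/-- A monotone self-map of `P_G` fixing all faces of rank 0 and rank 1 is inflationary. -/
lemma le_map_of_fixes_skeleton {V R : Type*} (G : SimpleGraph V) (c : V → V → R)
    {f : ColorfulFace G c → ColorfulFace G c} (hf : Monotone f)
    (h0 : ∀ x : ColorfulFace G c, faceRank G c x = 0 → f x = x)
    (h1 : ∀ x : ColorfulFace G c, faceRank G c x = 1 → f x = x) (x : ColorfulFace G c) :
    x ≤ f x := by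
  induction x using Quotient.ind with | _ p => ?_
  obtain ⟨C, v⟩ := p
  have hvertex : mkFace G c ∅ v ≤ f (mkFace G c C v) := by
    rw [← h0 (mkFace G c ∅ v) Finset.card_empty]
    exact hf ⟨Finset.empty_subset C, Reachable.refl _⟩
  have hedge : ∀ a ∈ C, mkFace G c {a} v ≤ f (mkFace G c C v) := fun a ha => by
    rw [← h1 (mkFace G c {a} v) (Finset.card_singleton a)]
    exact hf ⟨Finset.singleton_subset_iff.2 ha, Reachable.refl _⟩
  change mkFace G c C v ≤ f (mkFace G c C v)
  generalize f (mkFace G c C v) = y at hvertex hedge ⊢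
  induction y using Quotient.ind with | _ q => ?_
  exact ⟨fun a ha => (hedge a ha).1 (Finset.mem_singleton_self a), hvertex.2⟩

/-- every order automorphism of `P_G` fixing every face of rank 0 and every
face of rank 1 is the identity. -/
theorem colorful_automorphism_fixing_skeleton_is_id
    {V R : Type*} [Fintype V] [Fintype R] [DecidableEq R]
    (G : SimpleGraph V) (hconn : G.Connected) (c : V → V → R)
    (hc : IsProperColoring G c) (α : ColorfulFace G c ≃o ColorfulFace G c)
    (h0 : ∀ x : ColorfulFace G c, faceRank G c x = 0 → α x = x)
    (h1 : ∀ x : ColorfulFace G c, faceRank G c x = 1 → α x = x) :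
    ∀ x : ColorfulFace G c, α x = x := by
  intro x
  refine le_antisymm ?_ (le_map_of_fixes_skeleton G c α.monotone h0 h1 x)
  rw [← α.le_symm_apply]
  exact le_map_of_fixes_skeleton G c α.symm.monotone
    (fun y hy => α.symm_apply_eq.2 (h0 y hy).symm)
    (fun y hy => α.symm_apply_eq.2 (h1 y hy).symm) x
end

section
/- Let W be a group with a set S of pairwise distinct involutory generators, acting on the right, transitively and faithfully, on a nonempty set F, and suppose that for every Ψ ∈ F and all distinct s, s' ∈ S one has Ψ·s ≠ Ψ and Ψ·s ≠ Ψ·s'. Fix Φ ∈ F and let H ≤ W be the stabilizer of Φ. Let 𝒢_F be the edge-colored graph on F in which, for each s ∈ S, each pair {Ψ, Ψ·s} is an edge of color s. Then: (1) the map u H ↦ Φ·u⁻¹ is a well-defined bijection from the set of left cosets of H in W onto F; (2) for u, v ∈ W, there exist u', v' ∈ W with u'H = uH, v'H = vH and v' = s u' for some s ∈ S if and only if Φ·v⁻¹ = (Φ·u⁻¹)·s, and in this case the color s is uniquely determined by the coset pair (uH, vH); hence the quotient of the Cayley graph 𝒢(W,S) by the partition of its vertex set into left cosets of H is isomorphic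 to 𝒢_F as an edge-colored graph; (3) 𝒢(W,S) itself is isomorphic to 𝒢_F as an edge-colored graph if and only if the action of W on F is free (i.e., H is trivial). -/
open SimpleGraph

variable {W X : Type*} [Group W]

/-- The Cayley graph of `W` with respect to a set `S` of involutory generators. -/
def cayleyGraph (S : Set W) : SimpleGraph W :=
  SimpleGraph.fromRel (fun u v => ∃ s ∈ S, v = s * u)

/-- The flag adjacency graph `𝒢_F` of a right action `act` of `W` on `X`: for each
`s ∈ S`, each pair `{Ψ, Ψ·s}` is an edge (of color `s`). -/
def flagGraph (S : Set W) (act : X → W → X) : SimpleGraph X :=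
  SimpleGraph.fromRel (fun Ψ Ψ' => ∃ s ∈ S, Ψ' = act Ψ s)

/-- The stabilizer `H ≤ W` of a point `Φ` under a right action `act` of `W` on `X`. -/
def rightStab (act : X → W → X) (hone : ∀ Ψ : X, act Ψ 1 = Ψ)
    (hmul : ∀ (Ψ : X) (u v : W), act Ψ (u * v) = act (act Ψ u) v) (Φ : X) :
    Subgroup W where
  carrier := {u : W | act Φ u = Φ}
  one_mem' := hone Φ
  mul_mem' := by
    intro a b ha hb
    simp only [Set.mem_setOf_eq] at *
    rw [hmul, ha, hb]
  inv_mem' := by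
    intro a ha
    simp only [Set.mem_setOf_eq] at *
    have h1 : act Φ (a * a⁻¹) = act Φ a⁻¹ := by rw [hmul, ha]
    rw [mul_inv_cancel, hone] at h1
    exact h1.symm

/-- The quotient of the Cayley graph `𝒢(W,S)` by the partition of its vertex set into the
left cosets of the stabilizer `H` of `Φ`: two cosets are adjacent iff they contain
vertices adjacent in `𝒢(W,S)` (an edge coming from `s ∈ S` having color `s`). -/
def quotGraph (S : Set W) (act : X → W → X) (hone : ∀ Ψ : X, act Ψ 1 = Ψ)
    (hmul : ∀ (Ψ : X) (u v : W), act Ψ (u * v) = act (act Ψ u) v) (Φ : X) :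
    SimpleGraph (W ⧸ rightStab act hone hmul Φ) :=
  SimpleGraph.fromRel (fun x y => ∃ u v s : W, s ∈ S ∧
    (QuotientGroup.mk u : W ⧸ rightStab act hone hmul Φ) = x ∧
    (QuotientGroup.mk v : W ⧸ rightStab act hone hmul Φ) = y ∧ v = s * u)

/-- Inverting an element of `S` does nothing. -/
theorem inv_eq_self_of_mem {S : Set W} (hinv : ∀ s ∈ S, s * s = 1) {s : W} (hs : s ∈ S) :
    s⁻¹ = s :=
  inv_eq_of_mul_eq_one_left (hinv s hs)

section RightAction

variable {S : Set W} {act : X → W → X} (hone : ∀ Ψ : X, act Ψ 1 = Ψ)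
  (hmul : ∀ (Ψ : X) (u v : W), act Ψ (u * v) = act (act Ψ u) v) (Φ : X)

theorem act_eq_act_iff (hone : ∀ Ψ : X, act Ψ 1 = Ψ)
    (hmul : ∀ (Ψ : X) (u v : W), act Ψ (u * v) = act (act Ψ u) v) (Ψ Ψ' : X) (v : W) : act Ψ v = act Ψ' v ↔ Ψ = Ψ' := by
  refine ⟨fun h => ?_, fun h => h ▸ rfl⟩
  have h' := congrArg (fun x => act x v⁻¹) h
  simpa only [← hmul, mul_inv_cancel, hone] using h'

theorem mem_rightStab {u : W} : u ∈ rightStab act hone hmul Φ ↔ act Φ u = Φ := Iff.rfl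

/-- Two left cosets of the stabilizer agree iff their inverses move `Φ` to the same point. -/
theorem mk_eq_mk_iff_act_inv (u v : W) :
    (QuotientGroup.mk u : W ⧸ rightStab act hone hmul Φ) = QuotientGroup.mk v ↔
      act Φ u⁻¹ = act Φ v⁻¹ := by
  rw [QuotientGroup.eq, mem_rightStab, hmul, ← act_eq_act_iff hone hmul _ _ v⁻¹,
    ← hmul (act Φ u⁻¹), mul_inv_cancel, hone]

/-- Left multiplication by a generator becomes the right action of that generator. -/
theorem act_inv_mul (hmul : ∀ (Ψ : X) (u v : W), act Ψ (u * v) = act (act Ψ u) v)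
    (Ψ : X) (hinv : ∀ s ∈ S, s * s = 1) (u : W) {s : W} (hs : s ∈ S) :
    act Ψ (s * u)⁻¹ = act (act Ψ u⁻¹) s := by
  rw [mul_inv_rev, inv_eq_self_of_mem hinv hs, hmul]

/-- The cosets of `u` and `v` are joined by an edge of color `s` iff `Φ·v⁻¹ = (Φ·u⁻¹)·s`. -/
theorem exists_mk_eq_mul_iff (hinv : ∀ s ∈ S, s * s = 1) (u v : W) {s : W} (hs : s ∈ S) :
    (∃ u' v' : W,
        (QuotientGroup.mk u' : W ⧸ rightStab act hone hmul Φ) = QuotientGroup.mk u ∧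
        (QuotientGroup.mk v' : W ⧸ rightStab act hone hmul Φ) = QuotientGroup.mk v ∧
        v' = s * u') ↔
      act Φ v⁻¹ = act (act Φ u⁻¹) s := by
  simp only [mk_eq_mk_iff_act_inv]
  constructor
  · rintro ⟨u', v', hu, hv, rfl⟩
    rw [← hv, act_inv_mul hmul Φ hinv u' hs, hu]
  · intro h
    exact ⟨u, s * u, rfl, (act_inv_mul hmul Φ hinv u hs).trans h.symm, rfl⟩

/-- The bijection `uH ↦ Φ·u⁻¹` from the left cosets of the stabilizer onto `X`. -/
noncomputable def cosetEquiv (htrans : ∀ Ψ Ψ' : X, ∃ u : W, act Ψ u = Ψ') :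
    W ⧸ rightStab act hone hmul Φ ≃ X :=
  Equiv.ofBijective
    (fun x => Quotient.liftOn' x (fun u => act Φ u⁻¹) fun u v h =>
      (mk_eq_mk_iff_act_inv hone hmul Φ u v).1 (Quotient.sound' h)) <| by
    constructor
    · intro x y
      induction x using QuotientGroup.induction_on with | _ u
      induction y using QuotientGroup.induction_on with | _ v
      exact (mk_eq_mk_iff_act_inv hone hmul Φ u v).2
    · intro Ψ
      obtain ⟨u, hu⟩ := htrans Φ Ψ
      refine ⟨QuotientGroup.mk u⁻¹, ?_⟩
      change act Φ u⁻¹⁻¹ = Ψ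
      rw [inv_inv, hu]

theorem cosetEquiv_mk (htrans : ∀ Ψ Ψ' : X, ∃ u : W, act Ψ u = Ψ') (u : W) :
    cosetEquiv hone hmul Φ htrans (QuotientGroup.mk u) = act Φ u⁻¹ := rfl

/-- The edges of color in `S` between two cosets correspond to those of the flag graph. -/
theorem exists_edge_iff_cosetEquiv (htrans : ∀ Ψ Ψ' : X, ∃ u : W, act Ψ u = Ψ')
    (hinv : ∀ s ∈ S, s * s = 1) (x y : W ⧸ rightStab act hone hmul Φ) :
    (∃ s ∈ S, cosetEquiv hone hmul Φ htrans y = act (cosetEquiv hone hmul Φ htrans x) s) ↔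
      ∃ u v s : W, s ∈ S ∧ (QuotientGroup.mk u : W ⧸ rightStab act hone hmul Φ) = x ∧
        (QuotientGroup.mk v : W ⧸ rightStab act hone hmul Φ) = y ∧ v = s * u := by
  induction x using QuotientGroup.induction_on with | _ u
  induction y using QuotientGroup.induction_on with | _ v
  simp only [cosetEquiv_mk]
  constructor
  · rintro ⟨s, hs, h⟩
    obtain ⟨u', v', h'⟩ := (exists_mk_eq_mul_iff hone hmul Φ hinv u v hs).2 h
    exact ⟨u', v', s, hs, h'⟩
  · rintro ⟨u', v', s, hs, h'⟩
    exact ⟨s, hs, (exists_mk_eq_mul_iff hone hmul Φ hinv u v hs).1 ⟨u', v', h'⟩⟩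

/-- The quotient of the Cayley graph by the cosets of the stabilizer is the flag graph. -/
noncomputable def quotGraphIso (htrans : ∀ Ψ Ψ' : X, ∃ u : W, act Ψ u = Ψ')
    (hinv : ∀ s ∈ S, s * s = 1) :
    quotGraph S act hone hmul Φ ≃g flagGraph S act where
  toEquiv := cosetEquiv hone hmul Φ htrans
  map_rel_iff' := by
    intro x y
    simp only [flagGraph, quotGraph, SimpleGraph.fromRel_adj, ne_eq,
      EmbeddingLike.apply_eq_iff_eq, exists_edge_iff_cosetEquiv hone hmul Φ htrans hinv]

/-- A color-equivariant map from `W` sends `w * u` to the image of `u` moved by `w⁻¹`. -/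
theorem map_mul_eq_act_inv (hone : ∀ Ψ : X, act Ψ 1 = Ψ)
    (hmul : ∀ (Ψ : X) (u v : W), act Ψ (u * v) = act (act Ψ u) v)
    (hgen : Subgroup.closure S = ⊤) (hinv : ∀ s ∈ S, s * s = 1) {f : W → X}
    (hf : ∀ u σ : W, σ ∈ S → f (σ * u) = act (f u) σ) (w u : W) :
    f (w * u) = act (f u) w⁻¹ := by
  have hw : w ∈ Subgroup.closure S := hgen ▸ Subgroup.mem_top w
  induction hw using Subgroup.closure_induction generalizing u with
  | mem s hs => rw [hf u s hs, inv_eq_self_of_mem hinv hs]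
  | one => rw [one_mul, inv_one, hone]
  | mul a b _ _ iha ihb => rw [mul_assoc, iha, ihb, mul_inv_rev, hmul]
  | inv a _ iha =>
    have h := iha (a⁻¹ * u)
    rw [mul_inv_cancel_left] at h
    rw [h, ← hmul, inv_inv, inv_mul_cancel, hone]

theorem rightStab_eq_bot_of_equiv (hgen : Subgroup.closure S = ⊤)
    (hinv : ∀ s ∈ S, s * s = 1) (e : W ≃ X)
    (he : ∀ u σ : W, σ ∈ S → e (σ * u) = act (e u) σ) :
    rightStab act hone hmul Φ = ⊥ := by
  rw [eq_bot_iff]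
  intro h hh
  obtain ⟨u, rfl⟩ := e.surjective Φ
  have h' := map_mul_eq_act_inv hone hmul hgen hinv he h⁻¹ u
  rw [inv_inv, (mem_rightStab hone hmul _).1 hh, e.apply_eq_iff_eq, mul_eq_right,
    inv_eq_one] at h'
  exact Subgroup.mem_bot.2 h'

/-- If the stabilizer of `Φ` is trivial, `u ↦ Φ·u⁻¹` is a bijection. -/
theorem bijective_act_inv (htrans : ∀ Ψ Ψ' : X, ∃ u : W, act Ψ u = Ψ')
    (hbot : rightStab act hone hmul Φ = ⊥) :
    Function.Bijective fun u : W => act Φ u⁻¹ := by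
  constructor
  · intro u v h
    have h' := (mk_eq_mk_iff_act_inv hone hmul Φ u v).2 h
    rw [QuotientGroup.eq, hbot, Subgroup.mem_bot] at h'
    exact inv_mul_eq_one.1 h'
  · intro Ψ
    obtain ⟨u, hu⟩ := htrans Φ Ψ
    exact ⟨u⁻¹, by simpa only [inv_inv] using hu⟩

/-- A color-equivariant bijection is an isomorphism from the Cayley graph to the flag graph. -/
def cayleyGraphIsoOfEquiv (e : W ≃ X) (he : ∀ u σ : W, σ ∈ S → e (σ * u) = act (e u) σ) :
    cayleyGraph S ≃g flagGraph S act where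
  toEquiv := e
  map_rel_iff' := by
    have key (u v : W) : (∃ s ∈ S, e v = act (e u) s) ↔ ∃ s ∈ S, v = s * u :=
      exists_congr fun s => and_congr_right fun hs => by rw [← he u s hs, e.apply_eq_iff_eq]
    intro u v
    simp only [flagGraph, cayleyGraph, SimpleGraph.fromRel_adj, ne_eq,
      EmbeddingLike.apply_eq_iff_eq, key]

end RightAction

/-- for a transitive faithful right action of `W = ⟨S⟩` on `X` in which each
`s ∈ S` moves every point and distinct `s, s' ∈ S` move every point differently, with
`H` the stabilizer of a fixed `Φ ∈ X`:
(1) `uH ↦ Φ·u⁻¹` is a well-defined bijection from the left cosets of `H` onto `X`;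
(2) two cosets `uH`, `vH` are joined by an edge of color `s` in the quotient of the Cayley
graph `𝒢(W,S)` iff `Φ·v⁻¹ = (Φ·u⁻¹)·s`, the color `s` being uniquely determined by the
coset pair; hence the quotient graph is isomorphic to the flag graph `𝒢_F` as an
edge-colored graph;
(3) `𝒢(W,S)` itself is isomorphic to `𝒢_F` as an edge-colored graph iff the action is
free, i.e. iff `H` is trivial. -/
theorem monodromy_cayley_covers_flag_graph
    (S : Set W) (act : X → W → X)
    (hone : ∀ Ψ : X, act Ψ 1 = Ψ)
    (hmul : ∀ (Ψ : X) (u v : W), act Ψ (u * v) = act (act Ψ u) v)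
    (htrans : ∀ Ψ Ψ' : X, ∃ u : W, act Ψ u = Ψ')
    (hfaith : ∀ u : W, (∀ Ψ : X, act Ψ u = Ψ) → u = 1)
    (hX : Nonempty X)
    (hgen : Subgroup.closure S = ⊤)
    (hinv : ∀ s ∈ S, s * s = 1)
    (hmove : ∀ Ψ : X, ∀ s ∈ S, act Ψ s ≠ Ψ)
    (hdist : ∀ Ψ : X, ∀ s ∈ S, ∀ s' ∈ S, s ≠ s' → act Ψ s ≠ act Ψ s')
    (Φ : X) :
    (∃ e : W ⧸ rightStab act hone hmul Φ ≃ X,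
      ∀ u : W, e (QuotientGroup.mk u) = act Φ u⁻¹) ∧
    (∀ u v s : W, s ∈ S →
      ((∃ u' v' : W,
          (QuotientGroup.mk u' : W ⧸ rightStab act hone hmul Φ) = QuotientGroup.mk u ∧
          (QuotientGroup.mk v' : W ⧸ rightStab act hone hmul Φ) = QuotientGroup.mk v ∧
          v' = s * u') ↔
        act Φ v⁻¹ = act (act Φ u⁻¹) s)) ∧
    (∀ u v s s' : W, s ∈ S → s' ∈ S →
      (∃ u' v' : W,
        (QuotientGroup.mk u' : W ⧸ rightStab act hone hmul Φ) = QuotientGroup.mk u ∧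
        (QuotientGroup.mk v' : W ⧸ rightStab act hone hmul Φ) = QuotientGroup.mk v ∧
        v' = s * u') →
      (∃ u'' v'' : W,
        (QuotientGroup.mk u'' : W ⧸ rightStab act hone hmul Φ) = QuotientGroup.mk u ∧
        (QuotientGroup.mk v'' : W ⧸ rightStab act hone hmul Φ) = QuotientGroup.mk v ∧
        v'' = s' * u'') →
      s = s') ∧
    (∃ e : quotGraph S act hone hmul Φ ≃g flagGraph S act,
      ∀ u : W, e (QuotientGroup.mk u) = act Φ u⁻¹) ∧
    ((∃ e : cayleyGraph S ≃g flagGraph S act,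
        ∀ u σ : W, σ ∈ S → e (σ * u) = act (e u) σ) ↔
      rightStab act hone hmul Φ = ⊥) := by
  refine ⟨⟨cosetEquiv hone hmul Φ htrans, cosetEquiv_mk hone hmul Φ htrans⟩,
    fun u v s hs => exists_mk_eq_mul_iff hone hmul Φ hinv u v hs, ?_,
    ⟨quotGraphIso hone hmul Φ htrans hinv, cosetEquiv_mk hone hmul Φ htrans⟩, ?_, ?_⟩
  · intro u v s s' hs hs' h h'
    rw [exists_mk_eq_mul_iff hone hmul Φ hinv u v hs] at h
    rw [exists_mk_eq_mul_iff hone hmul Φ hinv u v hs'] at h'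
    by_contra hne
    exact hdist _ s hs s' hs' hne (h.symm.trans h')
  · rintro ⟨e, he⟩
    exact rightStab_eq_bot_of_equiv hone hmul Φ hgen hinv e.toEquiv he
  · intro hbot
    have he : ∀ u σ : W, σ ∈ S →
        Equiv.ofBijective _ (bijective_act_inv hone hmul Φ htrans hbot) (σ * u) =
          act (Equiv.ofBijective _ (bijective_act_inv hone hmul Φ htrans hbot) u) σ :=
      fun u _ hσ => act_inv_mul hmul Φ hinv u hσ
    exact ⟨cayleyGraphIsoOfEquiv _ he, he⟩
end
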